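/- arXiv:1507.00172 — 7 statements merged into one kernel-verified Lean document; each statement's English description precedes it below -/
import Mathlib

section
/- For every x ∈ U, the first-order Lie brackets are [f, g̃1](x) = −(cosφ/cosψ) e_θ + sinφ e_ψ − tanψ cosφ e_φ and [f, g̃2](x) = −(sinφ/cosψ) e_θ − cosφ e_ψ − tanψ sinφ e_φ. -/
open Real

/-- Lie bracket of vector fields on ℝ⁸: [X, Y](x) = DY(x)·X(x) − DX(x)·Y(x). -/
noncomputable def lieBracket (X Y : (Fin 8 → ℝ) → (Fin 8 → ℝ)) :
    (Fin 8 → ℝ) → (Fin 8 → ℝ) :=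
  fun x => fderiv ℝ Y x (X x) - fderiv ℝ X x (Y x)

/-- The drift vector field f of (MTCP), in coordinates
x = (v_x, v_y, v_z, θ, ψ, φ, ω_x, ω_y). -/
noncomputable def fMTCP (a gx gy gz : ℝ) : (Fin 8 → ℝ) → (Fin 8 → ℝ) := fun x =>
  ![a * sin (x 3) * cos (x 4) + gx,
    -a * sin (x 4) + gy,
    a * cos (x 3) * cos (x 4) + gz,
    (x 6 * sin (x 5) + x 7 * cos (x 5)) / cos (x 4),
    x 6 * cos (x 5) - x 7 * sin (x 5),
    tan (x 4) * (x 6 * sin (x 5) + x 7 * cos (x 5)),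
    0, 0]

/-- g̃1 = e_{ω_y}. -/
noncomputable def gt1 : (Fin 8 → ℝ) → (Fin 8 → ℝ) := fun _ => Pi.single 7 1

/-- g̃2 = e_{ω_x}. -/
noncomputable def gt2 : (Fin 8 → ℝ) → (Fin 8 → ℝ) := fun _ => Pi.single 6 1

theorem fderiv_apply_eq_of_affine_along {E F : Type*} [NormedAddCommGroup E] [NormedSpace ℝ E]
    [NormedAddCommGroup F] [NormedSpace ℝ F] {f : E → F} {x v : E} {w : F}
    (hf : DifferentiableAt ℝ f x) (h : ∀ t : ℝ, f (x + t • v) = f x + t • w) :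
    fderiv ℝ f x v = w := by
  rw [← hf.lineDeriv_eq_fderiv, lineDeriv]
  simp only [h]
  have hd : HasDerivAt (fun t : ℝ => f x + t • w) ((1 : ℝ) • w) 0 :=
    ((hasDerivAt_id (0 : ℝ)).smul_const w).const_add (f x)
  rw [hd.deriv, one_smul]

theorem differentiableAt_fMTCP (a gx gy gz : ℝ) {x : Fin 8 → ℝ} (hx : cos (x 4) ≠ 0) :
    DifferentiableAt ℝ (fMTCP a gx gy gz) x := by
  rw [differentiableAt_pi]
  intro i
  fin_cases i <;> simp [fMTCP, tan_eq_sin_div_cos] <;> fun_prop (disch := assumption)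

theorem lieBracket_const_eq_neg {X : (Fin 8 → ℝ) → (Fin 8 → ℝ)} {x v w : Fin 8 → ℝ}
    (hX : DifferentiableAt ℝ X x) (h : ∀ t : ℝ, X (x + t • v) = X x + t • w) :
    lieBracket X (fun _ => v) x = -w := by
  simp [lieBracket, fderiv_apply_eq_of_affine_along hX h]

/- STATEMENT 3: first-order Lie brackets [f, g̃1] and [f, g̃2] on U. -/
theorem first_order_brackets (a gx gy gz : ℝ) (x : Fin 8 → ℝ)
    (hx : cos (x 4) ≠ 0) :
    lieBracket (fMTCP a gx gy gz) gt1 x =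
      ![0, 0, 0, -(cos (x 5) / cos (x 4)), sin (x 5), -(tan (x 4) * cos (x 5)), 0, 0] ∧
    lieBracket (fMTCP a gx gy gz) gt2 x =
      ![0, 0, 0, -(sin (x 5) / cos (x 4)), -cos (x 5), -(tan (x 4) * sin (x 5)), 0, 0] := by
  have hf := differentiableAt_fMTCP a gx gy gz hx
  constructor
  · have h := lieBracket_const_eq_neg (v := Pi.single 7 1)
      (w := ![0, 0, 0, cos (x 5) / cos (x 4), -sin (x 5), tan (x 4) * cos (x 5), 0, 0]) hf
      fun t => by
        ext i
        fin_cases i <;> simp [fMTCP] <;> ring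
    unfold gt1
    simpa using h
  · have h := lieBracket_const_eq_neg (v := Pi.single 6 1)
      (w := ![0, 0, 0, sin (x 5) / cos (x 4), cos (x 5), tan (x 4) * sin (x 5), 0, 0]) hf
      fun t => by
        ext i
        fin_cases i <;> simp [fMTCP] <;> ring
    unfold gt2
    simpa using h
end

section
/- On U one has [g̃1, ad²f.g̃1] = 0 and [g̃2, ad²f.g̃2] = 0, while [g̃1, ad²f.g̃2](x) = e_φ and [g̃2, ad²f.g̃1](x) = −e_φ for every x ∈ U. -/
open Real

/-- The constant field `p e_{ω_x} + q e_{ω_y}`. -/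
noncomputable def controlField (p q : ℝ) : (Fin 8 → ℝ) → (Fin 8 → ℝ) := fun _ =>
  ![0, 0, 0, 0, 0, 0, p, q]

/-- The rates of the angles `(θ, ψ, φ)` for the angular velocity `(p, q)`. -/
noncomputable def angularField (p q : ℝ) : (Fin 8 → ℝ) → (Fin 8 → ℝ) := fun x =>
  ![0, 0, 0,
    (p * sin (x 5) + q * cos (x 5)) / cos (x 4),
    p * cos (x 5) - q * sin (x 5),
    sin (x 4) / cos (x 4) * (p * sin (x 5) + q * cos (x 5)),
    0, 0]

/-- The value of `ad² f` on `controlField p q` where `cos ψ ≠ 0`. -/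
noncomputable def adSqField (a p q : ℝ) : (Fin 8 → ℝ) → (Fin 8 → ℝ) := fun x =>
  ![a * (cos (x 3) * (p * sin (x 5) + q * cos (x 5))
      - sin (x 3) * sin (x 4) * (p * cos (x 5) - q * sin (x 5))),
    -a * cos (x 4) * (p * cos (x 5) - q * sin (x 5)),
    -a * (sin (x 3) * (p * sin (x 5) + q * cos (x 5))
      + cos (x 3) * sin (x 4) * (p * cos (x 5) - q * sin (x 5))),
    0, 0, p * x 7 - q * x 6, 0, 0]

theorem gt1_eq_controlField : gt1 = controlField 0 1 := by
  funext x i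
  fin_cases i <;> simp [gt1, controlField]

theorem gt2_eq_controlField : gt2 = controlField 1 0 := by
  funext x i
  fin_cases i <;> simp [gt2, controlField]

theorem eventually_cos_ne_zero {x : Fin 8 → ℝ} (hx : cos (x 4) ≠ 0) :
    ∀ᶠ y in nhds x, cos (y 4) ≠ 0 :=
  ContinuousAt.eventually_ne (g := fun y : Fin 8 → ℝ => cos (y 4))
    (continuous_cos.comp (continuous_apply 4)).continuousAt hx

theorem fderiv_apply_eq_of_hasDerivAt {F : (Fin 8 → ℝ) → (Fin 8 → ℝ)} {x v w : Fin 8 → ℝ}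
    (hF : DifferentiableAt ℝ F x)
    (h : ∀ i, HasDerivAt (fun t : ℝ => F (x + t • v) i) (w i) 0) :
    fderiv ℝ F x v = w := by
  rw [← hF.lineDeriv_eq_fderiv]
  exact HasLineDerivAt.lineDeriv (hasDerivAt_pi.2 h)

theorem hasDerivAt_line_apply (x v : Fin 8 → ℝ) (i : Fin 8) :
    HasDerivAt (fun t : ℝ => x i + t * v i) (v i) 0 := by
  simpa using ((hasDerivAt_id (0 : ℝ)).mul_const (v i)).const_add (x i)

theorem differentiableAt_angularField (p q : ℝ) {x : Fin 8 → ℝ} (hx : cos (x 4) ≠ 0) :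
    DifferentiableAt ℝ (angularField p q) x := by
  refine differentiableAt_pi.2 fun i => ?_
  fin_cases i <;> simp [angularField] <;> fun_prop (disch := assumption)

theorem differentiable_adSqField (a p q : ℝ) : Differentiable ℝ (adSqField a p q) := by
  refine differentiable_pi.2 fun i => ?_
  fin_cases i <;> simp [adSqField] <;> fun_prop

theorem fderiv_angularField (p q : ℝ) {x : Fin 8 → ℝ} (hx : cos (x 4) ≠ 0) (v : Fin 8 → ℝ) :
    fderiv ℝ (angularField p q) x v =
      ![0, 0, 0,
        (p * cos (x 5) - q * sin (x 5)) / cos (x 4) * v 5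
          + (p * sin (x 5) + q * cos (x 5)) * sin (x 4) / cos (x 4) ^ 2 * v 4,
        -(p * sin (x 5) + q * cos (x 5)) * v 5,
        (p * sin (x 5) + q * cos (x 5)) / cos (x 4) ^ 2 * v 4
          + sin (x 4) / cos (x 4) * (p * cos (x 5) - q * sin (x 5)) * v 5,
        0, 0] := by
  refine fderiv_apply_eq_of_hasDerivAt (differentiableAt_angularField p q hx) fun i => ?_
  have h4 := hasDerivAt_line_apply x v 4
  have h5 := hasDerivAt_line_apply x v 5
  have hS := (h5.sin.const_mul p).add (h5.cos.const_mul q)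
  have hC := (h5.cos.const_mul p).sub (h5.sin.const_mul q)
  have hx0 : cos (x 4 + 0 * v 4) ≠ 0 := by simpa using hx
  fin_cases i <;> simp only [angularField, Pi.add_apply, Pi.smul_apply, smul_eq_mul]
  · exact hasDerivAt_const _ _
  · exact hasDerivAt_const _ _
  · exact hasDerivAt_const _ _
  · refine (hS.div h4.cos hx0).congr_deriv ?_
    simp
    field_simp
    ring
  · refine hC.congr_deriv ?_
    simp
    ring
  · refine ((h4.sin.div h4.cos hx0).mul hS).congr_deriv ?_
    simp
    field_simp
    linear_combination (p * sin (x 5) + q * cos (x 5)) * v 4 * sin_sq_add_cos_sq (x 4)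
  · exact hasDerivAt_const _ _
  · exact hasDerivAt_const _ _

theorem fderiv_fMTCP (a gx gy gz : ℝ) {x : Fin 8 → ℝ} (hx : cos (x 4) ≠ 0) (v : Fin 8 → ℝ) :
    fderiv ℝ (fMTCP a gx gy gz) x v =
      ![a * (cos (x 3) * cos (x 4) * v 3 - sin (x 3) * sin (x 4) * v 4),
        -a * cos (x 4) * v 4,
        -a * (sin (x 3) * cos (x 4) * v 3 + cos (x 3) * sin (x 4) * v 4),
        0, 0, 0, 0, 0] + fderiv ℝ (angularField (x 6) (x 7)) x v
      + angularField (v 6) (v 7) x := by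
  rw [fderiv_angularField _ _ hx]
  refine fderiv_apply_eq_of_hasDerivAt (differentiableAt_fMTCP a gx gy gz hx) fun i => ?_
  have h3 := hasDerivAt_line_apply x v 3
  have h4 := hasDerivAt_line_apply x v 4
  have h5 := hasDerivAt_line_apply x v 5
  have h6 := hasDerivAt_line_apply x v 6
  have h7 := hasDerivAt_line_apply x v 7
  have hS := (h6.mul h5.sin).add (h7.mul h5.cos)
  have hx0 : cos (x 4 + 0 * v 4) ≠ 0 := by simpa using hx
  fin_cases i <;>
    simp only [fMTCP, tan_eq_sin_div_cos, Pi.add_apply, Pi.smul_apply, smul_eq_mul]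
  · refine (((h3.sin.const_mul a).mul h4.cos).add_const gx).congr_deriv ?_
    simp [angularField]
    ring
  · refine ((h4.sin.const_mul (-a)).add_const gy).congr_deriv ?_
    simp [angularField]
    ring
  · refine (((h3.cos.const_mul a).mul h4.cos).add_const gz).congr_deriv ?_
    simp [angularField]
    ring
  · refine (hS.div h4.cos hx0).congr_deriv ?_
    simp [angularField]
    field_simp
    ring
  · refine ((h6.mul h5.cos).sub (h7.mul h5.sin)).congr_deriv ?_
    simp [angularField]
    ring
  · refine ((h4.sin.div h4.cos hx0).mul hS).congr_deriv ?_
    simp [angularField]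
    field_simp
    linear_combination
      (x 6 * sin (x 5) + x 7 * cos (x 5)) * v 4 * sin_sq_add_cos_sq (x 4)
  · refine (hasDerivAt_const _ _).congr_deriv ?_
    simp [angularField]
  · refine (hasDerivAt_const _ _).congr_deriv ?_
    simp [angularField]

theorem lieBracket_fMTCP_controlField (a gx gy gz p q : ℝ) {x : Fin 8 → ℝ}
    (hx : cos (x 4) ≠ 0) :
    lieBracket (fMTCP a gx gy gz) (controlField p q) x = -angularField p q x := by
  have hc : fderiv ℝ (controlField p q) x = 0 := fderiv_const_apply _
  rw [lieBracket, hc, fderiv_fMTCP a gx gy gz hx, fderiv_angularField _ _ hx]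
  ext i
  fin_cases i <;> simp [controlField, angularField]

theorem lieBracket_fMTCP_lieBracket_controlField (a gx gy gz p q : ℝ) {x : Fin 8 → ℝ}
    (hx : cos (x 4) ≠ 0) :
    lieBracket (fMTCP a gx gy gz) (lieBracket (fMTCP a gx gy gz) (controlField p q)) x =
      adSqField a p q x := by
  have he : lieBracket (fMTCP a gx gy gz) (controlField p q) =ᶠ[nhds x] -angularField p q :=
    (eventually_cos_ne_zero hx).mono fun y hy =>
      lieBracket_fMTCP_controlField a gx gy gz p q hy
  rw [lieBracket, he.fderiv_eq, he.eq_of_nhds, fderiv_neg, fderiv_fMTCP a gx gy gz hx]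
  simp only [neg_apply, fderiv_angularField _ _ hx]
  ext i
  fin_cases i <;> simp [fMTCP, angularField, adSqField, tan_eq_sin_div_cos] <;> field_simp
  all_goals first
    | ring1
    | linear_combination (p * x 7 - q * x 6) *
        ((1 - sin (x 4) ^ 2) * sin_sq_add_cos_sq (x 5) - sin_sq_add_cos_sq (x 4))

theorem lieBracket_controlField_lieBracket_fMTCP_lieBracket (a gx gy gz p q r s : ℝ)
    {x : Fin 8 → ℝ} (hx : cos (x 4) ≠ 0) :
    lieBracket (controlField r s)
      (lieBracket (fMTCP a gx gy gz) (lieBracket (fMTCP a gx gy gz) (controlField p q))) x =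
      Pi.single 5 (p * s - q * r) := by
  have he : lieBracket (fMTCP a gx gy gz) (lieBracket (fMTCP a gx gy gz) (controlField p q))
      =ᶠ[nhds x] adSqField a p q :=
    (eventually_cos_ne_zero hx).mono fun y hy =>
      lieBracket_fMTCP_lieBracket_controlField a gx gy gz p q hy
  have hc : fderiv ℝ (controlField r s) x = 0 := fderiv_const_apply _
  rw [lieBracket, he.fderiv_eq, hc, zero_apply, sub_zero]
  refine fderiv_apply_eq_of_hasDerivAt (differentiable_adSqField a p q x) fun i => ?_
  have h6 := hasDerivAt_line_apply x (controlField r s x) 6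
  have h7 := hasDerivAt_line_apply x (controlField r s x) 7
  by_cases hi : i = 5
  · subst hi
    exact ((h7.const_mul p).sub (h6.const_mul q)).congr_deriv (by simp [controlField])
  · fin_cases i <;> first | exact absurd rfl hi | simp [adSqField, controlField, hasDerivAt_const]

/- STATEMENT 5: on U, [g̃1, ad²f.g̃1] = [g̃2, ad²f.g̃2] = 0, and
[g̃1, ad²f.g̃2](x) = e_φ, [g̃2, ad²f.g̃1](x) = −e_φ. -/
theorem goh_brackets (a gx gy gz : ℝ) (x : Fin 8 → ℝ)
    (hx : cos (x 4) ≠ 0) :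
    lieBracket gt1 (lieBracket (fMTCP a gx gy gz) (lieBracket (fMTCP a gx gy gz) gt1)) x = 0 ∧
    lieBracket gt2 (lieBracket (fMTCP a gx gy gz) (lieBracket (fMTCP a gx gy gz) gt2)) x = 0 ∧
    lieBracket gt1 (lieBracket (fMTCP a gx gy gz) (lieBracket (fMTCP a gx gy gz) gt2)) x
      = Pi.single 5 1 ∧
    lieBracket gt2 (lieBracket (fMTCP a gx gy gz) (lieBracket (fMTCP a gx gy gz) gt1)) x
      = -Pi.single 5 1 := by
  simp only [gt1_eq_controlField, gt2_eq_controlField,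
    lieBracket_controlField_lieBracket_fMTCP_lieBracket a gx gy gz _ _ _ _ hx]
  simp [Pi.single_neg]
end

section
/- If a ≠ 0, then for every x ∈ U the six vectors g̃1(x), g̃2(x), [f, g̃1](x), [f, g̃2](x), ad²f.g̃1(x), ad²f.g̃2(x) are linearly independent in ℝ⁸; equivalently, their span has dimension 6. -/
open Real

theorem eq_zero_of_rotation_eq_zero {c d t : ℝ} (h₁ : c * sin t - d * cos t = 0)
    (h₂ : c * cos t + d * sin t = 0) : c = 0 ∧ d = 0 :=
  ⟨by linear_combination sin t * h₁ + cos t * h₂ - c * sin_sq_add_cos_sq t,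
    by linear_combination sin t * h₂ - cos t * h₁ - d * sin_sq_add_cos_sq t⟩

theorem fderiv_fMTCP_apply (a gx gy gz : ℝ) {x : Fin 8 → ℝ} (hx : cos (x 4) ≠ 0)
    (w : Fin 8 → ℝ) :
    fderiv ℝ (fMTCP a gx gy gz) x w =
      ![a * cos (x 3) * cos (x 4) * w 3 - a * sin (x 3) * sin (x 4) * w 4,
        -a * cos (x 4) * w 4,
        -a * sin (x 3) * cos (x 4) * w 3 - a * cos (x 3) * sin (x 4) * w 4,
        (sin (x 5) * w 6 + cos (x 5) * w 7 + (x 6 * cos (x 5) - x 7 * sin (x 5)) * w 5)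
            / cos (x 4)
          + (x 6 * sin (x 5) + x 7 * cos (x 5)) * sin (x 4) * w 4 / cos (x 4) ^ 2,
        cos (x 5) * w 6 - sin (x 5) * w 7 - (x 6 * sin (x 5) + x 7 * cos (x 5)) * w 5,
        tan (x 4) * (sin (x 5) * w 6 + cos (x 5) * w 7
            + (x 6 * cos (x 5) - x 7 * sin (x 5)) * w 5)
          + (x 6 * sin (x 5) + x 7 * cos (x 5)) * w 4 / cos (x 4) ^ 2,
        0, 0] := by
  generalize hr : (![_, _, _, _, _, _, _, _] : Fin 8 → ℝ) = r
  have coord (i : Fin 8) : HasFDerivAt (fun y : Fin 8 → ℝ => y i)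
      (ContinuousLinearMap.proj (R := ℝ) (φ := fun _ : Fin 8 => ℝ) i) x := hasFDerivAt_apply i x
  have hs := ((coord 6).mul (coord 5).sin).add ((coord 7).mul (coord 5).cos)
  have hinv := (hasDerivAt_inv hx).comp_hasFDerivAt x (coord 4).cos
  have htan := (Real.hasDerivAt_tan hx).comp_hasFDerivAt x (coord 4)
  suffices key : ∀ i : Fin 8, ∃ L : (Fin 8 → ℝ) →L[ℝ] ℝ,
      HasFDerivAt (fun y => fMTCP a gx gy gz y i) L x ∧ L w = r i by
    choose L hL hLw using key
    rw [(hasFDerivAt_pi.2 hL).fderiv]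
    exact funext hLw
  intro i
  fin_cases i
  · exact ⟨_, (((coord 3).sin.const_mul a).mul (coord 4).cos).add_const gx, by simp [← hr]; ring⟩
  · exact ⟨_, ((coord 4).sin.const_mul (-a)).add_const gy, by simp [← hr]; ring⟩
  · exact ⟨_, (((coord 3).cos.const_mul a).mul (coord 4).cos).add_const gz, by simp [← hr]; ring⟩
  · exact ⟨_, hs.mul hinv, by simp [← hr]; field_simp; ring⟩
  · exact ⟨_, ((coord 6).mul (coord 5).cos).sub ((coord 7).mul (coord 5).sin), by simp [← hr]; ring⟩
  · exact ⟨_, htan.mul hs, by simp [← hr]; field_simp; ring⟩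
  · exact ⟨0, hasFDerivAt_const 0 x, by simp [← hr]⟩
  · exact ⟨0, hasFDerivAt_const 0 x, by simp [← hr]⟩

theorem lieBracket_const (X : (Fin 8 → ℝ) → Fin 8 → ℝ) (v x : Fin 8 → ℝ) :
    lieBracket X (fun _ => v) x = -fderiv ℝ X x v := by
  simp [lieBracket]

theorem fderiv_apply_eq_zero {Y : (Fin 8 → ℝ) → Fin 8 → ℝ} {x : Fin 8 → ℝ} {i : Fin 8}
    (h : ∀ᶠ y in nhds x, Y y i = 0) (w : Fin 8 → ℝ) : fderiv ℝ Y x w i = 0 := by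
  by_cases hY : DifferentiableAt ℝ Y x
  · have h₁ := hasFDerivAt_pi'.1 hY.hasFDerivAt i
    have h₂ : HasFDerivAt (fun y => Y y i) (0 : (Fin 8 → ℝ) →L[ℝ] ℝ) x :=
      (hasFDerivAt_const (0 : ℝ) x).congr_of_eventuallyEq h
    simpa using DFunLike.congr_fun (h₁.unique h₂) w
  · simp [fderiv_zero_of_not_differentiableAt hY]

theorem lieBracket_fMTCP_lieBracket_const_apply (a gx gy gz : ℝ) {x : Fin 8 → ℝ}
    (hx : cos (x 4) ≠ 0) {v : Fin 8 → ℝ} (h3 : v 3 = 0) (h4 : v 4 = 0) {i : Fin 8} (hi : i < 3) :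
    lieBracket (fMTCP a gx gy gz) (lieBracket (fMTCP a gx gy gz) fun _ => v) x i =
      fderiv ℝ (fMTCP a gx gy gz) x (fderiv ℝ (fMTCP a gx gy gz) x v) i := by
  have hU : ∀ᶠ y : Fin 8 → ℝ in nhds x, cos (y 4) ≠ 0 :=
    (by fun_prop : Continuous fun y : Fin 8 → ℝ => cos (y 4)).continuousAt.eventually_ne hx
  have h0 : ∀ᶠ y in nhds x, lieBracket (fMTCP a gx gy gz) (fun _ => v) y i = 0 := by
    filter_upwards [hU] with y hy
    rw [lieBracket_const, fderiv_fMTCP_apply a gx gy gz hy]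
    fin_cases i <;> simp_all
  rw [lieBracket, Pi.sub_apply, fderiv_apply_eq_zero h0, lieBracket_const, map_neg]
  simp

/- STATEMENT 6: if a ≠ 0, the six vectors g̃1(x), g̃2(x), [f,g̃1](x), [f,g̃2](x),
ad²f.g̃1(x), ad²f.g̃2(x) are linearly independent; equivalently their span has
dimension 6. -/
theorem six_brackets_independent (a gx gy gz : ℝ) (ha : a ≠ 0) (x : Fin 8 → ℝ)
    (hx : cos (x 4) ≠ 0) :
    LinearIndependent ℝ
      ![gt1 x, gt2 x,
        lieBracket (fMTCP a gx gy gz) gt1 x,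
        lieBracket (fMTCP a gx gy gz) gt2 x,
        lieBracket (fMTCP a gx gy gz) (lieBracket (fMTCP a gx gy gz) gt1) x,
        lieBracket (fMTCP a gx gy gz) (lieBracket (fMTCP a gx gy gz) gt2) x] ∧
    Module.finrank ℝ
      (Submodule.span ℝ (Set.range
        ![gt1 x, gt2 x,
          lieBracket (fMTCP a gx gy gz) gt1 x,
          lieBracket (fMTCP a gx gy gz) gt2 x,
          lieBracket (fMTCP a gx gy gz) (lieBracket (fMTCP a gx gy gz) gt1) x,
          lieBracket (fMTCP a gx gy gz) (lieBracket (fMTCP a gx gy gz) gt2) x])) = 6 := by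
  rw [and_iff_left_of_imp fun h => by simpa using finrank_span_eq_card h]
  have ad_gt1 := lieBracket_const (fMTCP a gx gy gz) (Pi.single 7 1) x
  have ad_gt2 := lieBracket_const (fMTCP a gx gy gz) (Pi.single 6 1) x
  have ad2_gt1 (i : Fin 8) (hi : i < 3) :=
    lieBracket_fMTCP_lieBracket_const_apply a gx gy gz hx (v := Pi.single 7 1)
      (by simp) (by simp) hi
  have ad2_gt2 (i : Fin 8) (hi : i < 3) :=
    lieBracket_fMTCP_lieBracket_const_apply a gx gy gz hx (v := Pi.single 6 1)
      (by simp) (by simp) hi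
  change lieBracket _ gt1 x = _ at ad_gt1
  change lieBracket _ gt2 x = _ at ad_gt2
  change ∀ i : Fin 8, i < 3 → lieBracket _ (lieBracket _ gt1) x i = _ at ad2_gt1
  change ∀ i : Fin 8, i < 3 → lieBracket _ (lieBracket _ gt2) x i = _ at ad2_gt2
  rw [Fintype.linearIndependent_iff]
  intro c hc
  have comp (i : Fin 8) := congrFun hc i
  have e0 := comp 0
  have e1 := comp 1
  have e2 := comp 2
  simp [Fin.sum_univ_six, ad_gt1, ad_gt2, ad2_gt1, ad2_gt2, gt1, gt2,
    fderiv_fMTCP_apply a gx gy gz hx] at e0 e1 e2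
  have hp : c 4 * sin (x 5) - c 5 * cos (x 5) = 0 :=
    (mul_eq_zero.1 (by linear_combination e1 :
      a * cos (x 4) * (c 4 * sin (x 5) - c 5 * cos (x 5)) = 0)).resolve_left (mul_ne_zero ha hx)
  have hq : c 4 * cos (x 5) + c 5 * sin (x 5) = 0 := by
    refine (mul_eq_zero.1 ?_).resolve_left ha
    field_simp at e0 e2
    linear_combination cos (x 3) * e0 - sin (x 3) * e2 -
      a * (c 4 * cos (x 5) + c 5 * sin (x 5)) * sin_sq_add_cos_sq (x 3)
  obtain ⟨h4, h5⟩ := eq_zero_of_rotation_eq_zero hp hq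
  have e3 := comp 3
  have e4 := comp 4
  have e6 := comp 6
  have e7 := comp 7
  simp [Fin.sum_univ_six, ad_gt1, ad_gt2, gt1, gt2, h4, h5,
    fderiv_fMTCP_apply a gx gy gz hx] at e3 e4 e6 e7
  obtain ⟨h2, h3⟩ := eq_zero_of_rotation_eq_zero (c := c 2) (d := c 3) (t := x 5)
    (by linear_combination e4) (by field_simp at e3; linear_combination -e3)
  intro i
  fin_cases i
  exacts [e7, e6, h2, h3, h4, h5]
end

section
/- Singular arcs of (MTCP) are normal and carry zero control. Precisely: let a ≠ 0, b̄ ≠ 0 and p⁰ ∈ ℝ be constants, let I ⊂ ℝ be a nonempty open interval, and let x, p : I → ℝ⁸ be differentiable and u1, u2 : I → ℝ be such that (x, p, u) satisfies the (MTCP) state and adjoint equations at every t ∈ I, with cosθ(t) ≠ 0, cosψ(t) ≠ 0, a + g_x sinθ(t)cosψ(t) − g_y sinψ(t) + g_z cosθ(t)cosψ(t) ≠ 0, (p(t), p⁰) ≠ (0, 0), and H(x(t), p(t), u(t)) = 0 for every t ∈ I. Assume p_{ω_x}(t) = p_{ω_y}(t) = p_φ(t) = 0 for every t ∈ I (the singular-arc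 condition together with the Goh condition). Then for every t ∈ I: p_θ(t) = p_ψ(t) = 0; ω_x(t) = ω_y(t) = 0; u1(t) = u2(t) = 0; p_{v_x} = tanθ(t)·p_{v_z}; p_{v_y} = −(tanψ(t)/cosθ(t))·p_{v_z}; p_{v_z} = −p⁰ cosθ(t) cosψ(t)/(a + g_x sinθ(t)cosψ(t) − g_y sinψ(t) + g_z cosθ(t)cosψ(t)); moreover p⁰ ≠ 0 and p_{v_z} ≠ 0. -/
open Real

/-- A function vanishing on an open interval has zero derivative there. -/
lemma HasDerivAt.eq_zero_of_forall_Ioo_eq_zero {f : ℝ → ℝ} {a b f' t : ℝ}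
    (hf : ∀ s ∈ Set.Ioo a b, f s = 0) (ht : t ∈ Set.Ioo a b) (h : HasDerivAt f f' t) :
    f' = 0 := by
  have hev : f =ᶠ[nhds t] fun _ ↦ 0 := by
    filter_upwards [isOpen_Ioo.mem_nhds ht] with s hs using hf s hs
  exact h.unique ((hasDerivAt_const t (0 : ℝ)).congr_of_eventuallyEq hev)

/-- A rotation of the plane has trivial kernel. -/
lemma eq_zero_of_rotation_eq_zero_s8 {x y α : ℝ} (h₁ : x * sin α + y * cos α = 0)
    (h₂ : x * cos α - y * sin α = 0) : x = 0 ∧ y = 0 := by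
  have h := sin_sq_add_cos_sq α
  constructor
  · linear_combination sin α * h₁ + cos α * h₂ - x * h
  · linear_combination cos α * h₁ - sin α * h₂ - y * h

/- STATEMENT 8: Singular arcs of (MTCP) are normal and carry zero control.
An extremal of (MTCP) on a nonempty open interval I = (t1, t2), satisfying the
singular-arc/Goh condition p_{ωx} = p_{ωy} = p_φ ≡ 0, must satisfy
p_θ = p_ψ = 0, ω_x = ω_y = 0, u1 = u2 = 0, the stated relations between the
adjoint velocity components, p⁰ ≠ 0 and p_{v_z} ≠ 0. -/
theorem singular_arcs_normal_zero_control
    (a bbar gx gy gz p0 : ℝ) (ha : a ≠ 0) (hb : bbar ≠ 0)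
    (t1 t2 : ℝ) (ht : t1 < t2)
    (vx vy vz θ ψ φ ωx ωy : ℝ → ℝ)
    (pvx pvy pvz pθ pψ pφ pωx pωy : ℝ → ℝ)
    (u1 u2 : ℝ → ℝ)
    -- state equations
    (hvx : ∀ t ∈ Set.Ioo t1 t2, HasDerivAt vx (a * sin (θ t) * cos (ψ t) + gx) t)
    (hvy : ∀ t ∈ Set.Ioo t1 t2, HasDerivAt vy (-a * sin (ψ t) + gy) t)
    (hvz : ∀ t ∈ Set.Ioo t1 t2, HasDerivAt vz (a * cos (θ t) * cos (ψ t) + gz) t)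
    (hθ : ∀ t ∈ Set.Ioo t1 t2,
      HasDerivAt θ ((ωx t * sin (φ t) + ωy t * cos (φ t)) / cos (ψ t)) t)
    (hψ : ∀ t ∈ Set.Ioo t1 t2,
      HasDerivAt ψ (ωx t * cos (φ t) - ωy t * sin (φ t)) t)
    (hφ : ∀ t ∈ Set.Ioo t1 t2,
      HasDerivAt φ (tan (ψ t) * (ωx t * sin (φ t) + ωy t * cos (φ t))) t)
    (hωx : ∀ t ∈ Set.Ioo t1 t2, HasDerivAt ωx (-bbar * u2 t) t)
    (hωy : ∀ t ∈ Set.Ioo t1 t2, HasDerivAt ωy (bbar * u1 t) t)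
    -- adjoint equations
    (hpvx : ∀ t ∈ Set.Ioo t1 t2, HasDerivAt pvx 0 t)
    (hpvy : ∀ t ∈ Set.Ioo t1 t2, HasDerivAt pvy 0 t)
    (hpvz : ∀ t ∈ Set.Ioo t1 t2, HasDerivAt pvz 0 t)
    (hpθ : ∀ t ∈ Set.Ioo t1 t2,
      HasDerivAt pθ (-a * cos (ψ t) * (pvx t * cos (θ t) - pvz t * sin (θ t))) t)
    (hpψ : ∀ t ∈ Set.Ioo t1 t2,
      HasDerivAt pψ (a * sin (ψ t) * sin (θ t) * pvx t + a * cos (ψ t) * pvy t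
        + a * cos (θ t) * sin (ψ t) * pvz t
        - sin (ψ t) * (ωx t * sin (φ t) + ωy t * cos (φ t)) / (cos (ψ t)) ^ 2 * pθ t
        - (ωx t * sin (φ t) + ωy t * cos (φ t)) / (cos (ψ t)) ^ 2 * pφ t) t)
    (hpφ : ∀ t ∈ Set.Ioo t1 t2,
      HasDerivAt pφ (-(ωx t * cos (φ t) - ωy t * sin (φ t)) / cos (ψ t) * pθ t
        + (ωx t * sin (φ t) + ωy t * cos (φ t)) * pψ t
        - tan (ψ t) * (ωx t * cos (φ t) - ωy t * sin (φ t)) * pφ t) t)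
    (hpωx : ∀ t ∈ Set.Ioo t1 t2,
      HasDerivAt pωx (-(sin (φ t) / cos (ψ t)) * pθ t - cos (φ t) * pψ t
        - sin (ψ t) * sin (φ t) / cos (ψ t) * pφ t) t)
    (hpωy : ∀ t ∈ Set.Ioo t1 t2,
      HasDerivAt pωy (-(cos (φ t) / cos (ψ t)) * pθ t + sin (φ t) * pψ t
        - sin (ψ t) * cos (φ t) / cos (ψ t) * pφ t) t)
    -- nondegeneracy conditions along I
    (hcosθ : ∀ t ∈ Set.Ioo t1 t2, cos (θ t) ≠ 0)
    (hcosψ : ∀ t ∈ Set.Ioo t1 t2, cos (ψ t) ≠ 0)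
    (hden : ∀ t ∈ Set.Ioo t1 t2,
      a + gx * sin (θ t) * cos (ψ t) - gy * sin (ψ t)
        + gz * cos (θ t) * cos (ψ t) ≠ 0)
    (hnontriv : ∀ t ∈ Set.Ioo t1 t2,
      ¬(pvx t = 0 ∧ pvy t = 0 ∧ pvz t = 0 ∧ pθ t = 0 ∧ pψ t = 0 ∧ pφ t = 0
        ∧ pωx t = 0 ∧ pωy t = 0 ∧ p0 = 0))
    -- vanishing of the Hamiltonian
    (hH : ∀ t ∈ Set.Ioo t1 t2,
      pvx t * (a * sin (θ t) * cos (ψ t) + gx)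
      + pvy t * (-a * sin (ψ t) + gy)
      + pvz t * (a * cos (θ t) * cos (ψ t) + gz)
      + pθ t * ((ωx t * sin (φ t) + ωy t * cos (φ t)) / cos (ψ t))
      + pψ t * (ωx t * cos (φ t) - ωy t * sin (φ t))
      + pφ t * (tan (ψ t) * (ωx t * sin (φ t) + ωy t * cos (φ t)))
      - u2 t * bbar * pωx t + u1 t * bbar * pωy t + p0 = 0)
    -- singular arc condition together with the Goh condition
    (hsing : ∀ t ∈ Set.Ioo t1 t2, pωx t = 0 ∧ pωy t = 0 ∧ pφ t = 0) :
    (∀ t ∈ Set.Ioo t1 t2,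
      pθ t = 0 ∧ pψ t = 0 ∧ ωx t = 0 ∧ ωy t = 0 ∧ u1 t = 0 ∧ u2 t = 0 ∧
      pvx t = tan (θ t) * pvz t ∧
      pvy t = -(tan (ψ t) / cos (θ t)) * pvz t ∧
      pvz t = -p0 * cos (θ t) * cos (ψ t) /
        (a + gx * sin (θ t) * cos (ψ t) - gy * sin (ψ t)
          + gz * cos (θ t) * cos (ψ t)) ∧
      pvz t ≠ 0) ∧
    p0 ≠ 0 := by
  have hpθψ : ∀ t ∈ Set.Ioo t1 t2, pθ t = 0 ∧ pψ t = 0 := by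
    intro t ht
    have hx := (hpωx t ht).eq_zero_of_forall_Ioo_eq_zero (fun s hs ↦ (hsing s hs).1) ht
    have hy := (hpωy t ht).eq_zero_of_forall_Ioo_eq_zero (fun s hs ↦ (hsing s hs).2.1) ht
    rw [(hsing t ht).2.2] at hx hy
    obtain ⟨h₁, h₂⟩ := eq_zero_of_rotation_eq_zero_s8
      (x := pθ t / cos (ψ t)) (y := pψ t) (α := φ t)
      (by linear_combination -hx) (by linear_combination -hy)
    exact ⟨(div_eq_zero_iff.mp h₁).resolve_right (hcosψ t ht), h₂⟩
  have hθ_orth : ∀ t ∈ Set.Ioo t1 t2, pvx t * cos (θ t) - pvz t * sin (θ t) = 0 := by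
    intro t ht
    have h := (hpθ t ht).eq_zero_of_forall_Ioo_eq_zero (fun s hs ↦ (hpθψ s hs).1) ht
    exact (mul_eq_zero.mp h).resolve_left (mul_ne_zero (neg_ne_zero.mpr ha) (hcosψ t ht))
  have hψ_orth : ∀ t ∈ Set.Ioo t1 t2,
      sin (ψ t) * (pvx t * sin (θ t) + pvz t * cos (θ t)) + cos (ψ t) * pvy t = 0 := by
    intro t ht
    have h := (hpψ t ht).eq_zero_of_forall_Ioo_eq_zero (fun s hs ↦ (hpθψ s hs).2) ht
    rw [(hpθψ t ht).1, (hsing t ht).2.2] at h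
    refine (mul_eq_zero.mp ?_).resolve_left ha
    linear_combination h
  have hpvz_radial : ∀ t ∈ Set.Ioo t1 t2,
      cos (θ t) * (pvx t * sin (θ t) + pvz t * cos (θ t)) = pvz t := by
    intro t ht
    linear_combination sin (θ t) * hθ_orth t ht + pvz t * sin_sq_add_cos_sq (θ t)
  have hH_red : ∀ t ∈ Set.Ioo t1 t2,
      pvx t * (a * sin (θ t) * cos (ψ t) + gx) + pvy t * (-a * sin (ψ t) + gy)
        + pvz t * (a * cos (θ t) * cos (ψ t) + gz) + p0 = 0 := by
    intro t ht
    have h := hH t ht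
    obtain ⟨h₁, h₂, h₃⟩ := hsing t ht
    rw [(hpθψ t ht).1, (hpθψ t ht).2, h₁, h₂, h₃] at h
    linear_combination h
  have hpvx_eq : ∀ t ∈ Set.Ioo t1 t2, pvx t = tan (θ t) * pvz t := by
    intro t ht
    have := hcosθ t ht
    rw [tan_eq_sin_div_cos]
    field_simp
    linear_combination hθ_orth t ht
  have hpvy_eq : ∀ t ∈ Set.Ioo t1 t2, pvy t = -(tan (ψ t) / cos (θ t)) * pvz t := by
    intro t ht
    have := hcosθ t ht
    have := hcosψ t ht
    rw [tan_eq_sin_div_cos]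
    field_simp
    linear_combination cos (θ t) * hψ_orth t ht - sin (ψ t) * hpvz_radial t ht
  have hpvz_ne : ∀ t ∈ Set.Ioo t1 t2, pvz t ≠ 0 := by
    intro t ht hz
    have hx : pvx t = 0 := by rw [hpvx_eq t ht, hz, mul_zero]
    have hy : pvy t = 0 := by rw [hpvy_eq t ht, hz, mul_zero]
    have h := hH_red t ht
    rw [hx, hy, hz] at h
    exact hnontriv t ht ⟨hx, hy, hz, (hpθψ t ht).1, (hpθψ t ht).2, (hsing t ht).2.2,
      (hsing t ht).1, (hsing t ht).2.1, by linarith⟩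
  have hpvz_mul : ∀ t ∈ Set.Ioo t1 t2,
      pvz t * (a + gx * sin (θ t) * cos (ψ t) - gy * sin (ψ t)
        + gz * cos (θ t) * cos (ψ t)) = -p0 * cos (θ t) * cos (ψ t) := by
    intro t ht
    have hx : pvx t * cos (θ t) = pvz t * sin (θ t) := by linear_combination hθ_orth t ht
    have hy : pvy t * (cos (θ t) * cos (ψ t)) = -(sin (ψ t) * pvz t) := by
      linear_combination cos (θ t) * hψ_orth t ht - sin (ψ t) * hpvz_radial t ht
    linear_combination cos (θ t) * cos (ψ t) * hH_red t ht
      - cos (ψ t) * (a * sin (θ t) * cos (ψ t) + gx) * hx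
      - (-a * sin (ψ t) + gy) * hy
      - pvz t * a * cos (ψ t) ^ 2 * sin_sq_add_cos_sq (θ t)
      - pvz t * a * sin_sq_add_cos_sq (ψ t)
  have hradial_ne : ∀ t ∈ Set.Ioo t1 t2, pvx t * sin (θ t) + pvz t * cos (θ t) ≠ 0 := by
    intro t ht h
    exact hpvz_ne t ht (by rw [← hpvz_radial t ht, h, mul_zero])
  have hω : ∀ t ∈ Set.Ioo t1 t2, ωx t = 0 ∧ ωy t = 0 := by
    intro t ht
    have hsinθ := (hθ t ht).sin
    have hcosθ' := (hθ t ht).cos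
    have hθ_deriv := (((hpvx t ht).mul hcosθ').sub
      ((hpvz t ht).mul hsinθ)).eq_zero_of_forall_Ioo_eq_zero hθ_orth ht
    have hψ_deriv := (((hψ t ht).sin.mul (((hpvx t ht).mul hsinθ).add
      ((hpvz t ht).mul hcosθ'))).add
      ((hψ t ht).cos.mul (hpvy t ht))).eq_zero_of_forall_Ioo_eq_zero hψ_orth ht
    simp only [Pi.add_apply, Pi.mul_apply] at hψ_deriv
    refine eq_zero_of_rotation_eq_zero_s8 (α := φ t) ?_ ?_
    · refine (div_eq_zero_iff.mp ?_).resolve_right (hcosψ t ht)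
      refine (mul_eq_zero.mp ?_).resolve_right (hradial_ne t ht)
      linear_combination -hθ_deriv
    · refine (mul_eq_zero.mp ?_).resolve_right (hradial_ne t ht)
      linear_combination cos (ψ t) * hψ_deriv
        - cos (ψ t) * sin (ψ t) * ((ωx t * sin (φ t) + ωy t * cos (φ t)) / cos (ψ t))
          * hθ_orth t ht
        + (ωx t * cos (φ t) - ωy t * sin (φ t)) * sin (ψ t) * hψ_orth t ht
        - (ωx t * cos (φ t) - ωy t * sin (φ t))
          * (pvx t * sin (θ t) + pvz t * cos (θ t)) * sin_sq_add_cos_sq (ψ t)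
  refine ⟨fun t ht ↦ ⟨(hpθψ t ht).1, (hpθψ t ht).2, (hω t ht).1, (hω t ht).2, ?_, ?_,
    hpvx_eq t ht, hpvy_eq t ht, ?_, hpvz_ne t ht⟩, ?_⟩
  · have h := (hωy t ht).eq_zero_of_forall_Ioo_eq_zero (fun s hs ↦ (hω s hs).2) ht
    exact (mul_eq_zero.mp h).resolve_left hb
  · have h := (hωx t ht).eq_zero_of_forall_Ioo_eq_zero (fun s hs ↦ (hω s hs).1) ht
    exact (mul_eq_zero.mp h).resolve_left (neg_ne_zero.mpr hb)
  · rw [eq_div_iff (hden t ht)]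
    exact hpvz_mul t ht
  · rintro rfl
    obtain ⟨t, ht⟩ := Set.nonempty_Ioo.mpr ht
    exact mul_ne_zero (hpvz_ne t ht) (hden t ht) (by simpa using hpvz_mul t ht)
end

section
/- Every point of the singular surface generates a singular extremal of (MTCP) with zero control and constant attitude. Precisely: fix reals a, b̄, g_x, g_y, g_z, p⁰ and θ0, ψ0, φ0 with cosθ0 ≠ 0, cosψ0 ≠ 0 and d := a + g_x sinθ0 cosψ0 − g_y sinψ0 + g_z cosθ0 cosψ0 ≠ 0. Define the constants p_{v_z} = −p⁰ cosθ0 cosψ0/d, p_{v_x} = tanθ0 · p_{v_z}, p_{v_y} = −(tanψ0/cosθ0) · p_{v_z}, and, for given initial velocities (v_{x0}, v_{y0}, v_{z0}), define the curves x(t) = (v_{x0} + t(a sinθ0 cosψ0 + g_x), v_{y0} + t(−a sinψ0 + g_y), v_{z0} + t(a cosθ0 cosψ0 + g_z), θ0, ψ0, φ0, 0, 0) and p(t) = (p_{v_x}, p_{v_y}, p_{v_z}, 0, 0, 0, 0, 0). Then (x, p), together with the zero control u1 ≡ u2 ≡ 0, satisfies the (MTCP) state and adjoint equations for all t ∈ ℝ,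 and the Hamiltonian H vanishes identically along it. -/
open Real

theorem hasDerivAt_const_add_mul_const (v c t : ℝ) :
    HasDerivAt (fun s : ℝ => v + s * c) c t := by
  simpa using ((hasDerivAt_id t).mul_const c).const_add v

theorem hasDerivAt_const_of_eq_zero (c t : ℝ) {y : ℝ} (hy : y = 0) :
    HasDerivAt (fun _ : ℝ => c) y t :=
  hy ▸ hasDerivAt_const t c

/- STATEMENT 9: Every point of the singular surface generates a singular extremal of
(MTCP) with zero control and constant attitude: the explicitly given curves (x, p)
with u1 ≡ u2 ≡ 0 satisfy the (MTCP) state and adjoint equations for all t ∈ ℝ, and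
the Hamiltonian vanishes identically along them. -/
theorem singular_surface_generates_extremal
    (a bbar gx gy gz p0 θ0 ψ0 φ0 vx0 vy0 vz0 : ℝ)
    (hθ : cos θ0 ≠ 0) (hψ : cos ψ0 ≠ 0)
    (hd : a + gx * sin θ0 * cos ψ0 - gy * sin ψ0 + gz * cos θ0 * cos ψ0 ≠ 0) :
    let d := a + gx * sin θ0 * cos ψ0 - gy * sin ψ0 + gz * cos θ0 * cos ψ0
    let pvz := -p0 * cos θ0 * cos ψ0 / d
    let pvx := tan θ0 * pvz
    let pvy := -(tan ψ0 / cos θ0) * pvz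
    ∀ t : ℝ,
      -- state equations along the curve x(t)
      (HasDerivAt (fun s => vx0 + s * (a * sin θ0 * cos ψ0 + gx))
        (a * sin θ0 * cos ψ0 + gx) t) ∧
      (HasDerivAt (fun s => vy0 + s * (-a * sin ψ0 + gy)) (-a * sin ψ0 + gy) t) ∧
      (HasDerivAt (fun s => vz0 + s * (a * cos θ0 * cos ψ0 + gz))
        (a * cos θ0 * cos ψ0 + gz) t) ∧
      (HasDerivAt (fun _ : ℝ => θ0) ((0 * sin φ0 + 0 * cos φ0) / cos ψ0) t) ∧
      (HasDerivAt (fun _ : ℝ => ψ0) (0 * cos φ0 - 0 * sin φ0) t) ∧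
      (HasDerivAt (fun _ : ℝ => φ0) (tan ψ0 * (0 * sin φ0 + 0 * cos φ0)) t) ∧
      (HasDerivAt (fun _ : ℝ => (0 : ℝ)) (-bbar * 0) t) ∧   -- ω̇_x = −b̄ u2, u2 = 0
      (HasDerivAt (fun _ : ℝ => (0 : ℝ)) (bbar * 0) t) ∧    -- ω̇_y = b̄ u1, u1 = 0
      -- adjoint equations along the curve p(t)
      (HasDerivAt (fun _ : ℝ => pvx) 0 t) ∧
      (HasDerivAt (fun _ : ℝ => pvy) 0 t) ∧
      (HasDerivAt (fun _ : ℝ => pvz) 0 t) ∧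
      (HasDerivAt (fun _ : ℝ => (0 : ℝ))
        (-a * cos ψ0 * (pvx * cos θ0 - pvz * sin θ0)) t) ∧
      (HasDerivAt (fun _ : ℝ => (0 : ℝ))
        (a * sin ψ0 * sin θ0 * pvx + a * cos ψ0 * pvy + a * cos θ0 * sin ψ0 * pvz
          - sin ψ0 * (0 * sin φ0 + 0 * cos φ0) / (cos ψ0) ^ 2 * 0
          - (0 * sin φ0 + 0 * cos φ0) / (cos ψ0) ^ 2 * 0) t) ∧
      (HasDerivAt (fun _ : ℝ => (0 : ℝ))
        (-(0 * cos φ0 - 0 * sin φ0) / cos ψ0 * 0 + (0 * sin φ0 + 0 * cos φ0) * 0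
          - tan ψ0 * (0 * cos φ0 - 0 * sin φ0) * 0) t) ∧
      (HasDerivAt (fun _ : ℝ => (0 : ℝ))
        (-(sin φ0 / cos ψ0) * 0 - cos φ0 * 0 - sin ψ0 * sin φ0 / cos ψ0 * 0) t) ∧
      (HasDerivAt (fun _ : ℝ => (0 : ℝ))
        (-(cos φ0 / cos ψ0) * 0 + sin φ0 * 0 - sin ψ0 * cos φ0 / cos ψ0 * 0) t) ∧
      -- the Hamiltonian vanishes identically
      (pvx * (a * sin θ0 * cos ψ0 + gx) + pvy * (-a * sin ψ0 + gy)
        + pvz * (a * cos θ0 * cos ψ0 + gz)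
        + 0 * ((0 * sin φ0 + 0 * cos φ0) / cos ψ0)
        + 0 * (0 * cos φ0 - 0 * sin φ0)
        + 0 * (tan ψ0 * (0 * sin φ0 + 0 * cos φ0))
        - 0 * bbar * 0 + 0 * bbar * 0 + p0 = 0) := by
  intro d pvz pvx pvy t
  have hpvz : pvz * d = -p0 * cos θ0 * cos ψ0 := div_mul_cancel₀ _ hd
  have hpvx : pvx * cos θ0 = pvz * sin θ0 := by
    simp only [pvx, tan_eq_sin_div_cos]
    field_simp
  have hpvy : pvy * (cos θ0 * cos ψ0) = -(pvz * sin ψ0) := by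
    simp only [pvy, tan_eq_sin_div_cos]
    field_simp
  have hd_eq : d = a + gx * sin θ0 * cos ψ0 - gy * sin ψ0 + gz * cos θ0 * cos ψ0 := rfl
  clear_value pvx pvy pvz d
  have hsθ := sin_sq_add_cos_sq θ0
  have hsψ := sin_sq_add_cos_sq ψ0
  refine ⟨hasDerivAt_const_add_mul_const _ _ t, hasDerivAt_const_add_mul_const _ _ t,
    hasDerivAt_const_add_mul_const _ _ t, hasDerivAt_const_of_eq_zero _ t (by simp),
    hasDerivAt_const_of_eq_zero _ t (by simp), hasDerivAt_const_of_eq_zero _ t (by simp),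
    hasDerivAt_const_of_eq_zero _ t (by simp), hasDerivAt_const_of_eq_zero _ t (by simp),
    hasDerivAt_const t _, hasDerivAt_const t _, hasDerivAt_const t _,
    hasDerivAt_const_of_eq_zero _ t ?_, hasDerivAt_const_of_eq_zero _ t ?_,
    hasDerivAt_const_of_eq_zero _ t (by simp), hasDerivAt_const_of_eq_zero _ t (by simp),
    hasDerivAt_const_of_eq_zero _ t (by simp), ?_⟩
  · rw [hpvx, sub_self, mul_zero]
  · apply mul_left_cancel₀ hθ
    linear_combination a * sin ψ0 * sin θ0 * hpvx + a * hpvy + a * sin ψ0 * pvz * hsθ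
  · apply mul_left_cancel₀ (mul_ne_zero hθ hψ)
    linear_combination cos ψ0 * (a * sin θ0 * cos ψ0 + gx) * hpvx
      + (-a * sin ψ0 + gy) * hpvy + hpvz - pvz * hd_eq
      + pvz * a * cos ψ0 ^ 2 * hsθ + pvz * a * hsψ
end

section
/- At a switching point of order 2 the control is continuous: let ε > 0 and Φ : (−ε, ε) → ℝ² be of class C² with Φ(0) = (0,0), Φ′(0) = (0,0) and Φ″(0) = (α1, α2) ≠ (0,0). Then Φ(t) ≠ (0,0) for all t ≠ 0 sufficiently small, and Φ(t)/‖Φ(t)‖ → (α1, α2)/√(α1² + α2²) as t → 0 with t ≠ 0; in particular the feedback control u = Φ/‖Φ‖ extends continuously through the switching point. -/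
open Filter

/-- Second-order Taylor expansion at a critical zero, in quotient form. -/
theorem tendsto_div_sq_of_contDiffAt_two {f : ℝ → ℝ} (hf : ContDiffAt ℝ 2 f 0)
    (h0 : f 0 = 0) (h1 : deriv f 0 = 0) :
    Tendsto (fun t => f t / t ^ 2) (nhdsWithin 0 {(0 : ℝ)}ᶜ)
      (nhds (deriv (deriv f) 0 / 2)) := by
  have hdiff : ∀ᶠ t in nhds (0 : ℝ), DifferentiableAt ℝ f t :=
    (hf.eventually (by simp)).mono fun t ht => ht.differentiableAt (by norm_num)
  have hderiv : HasDerivAt (deriv f) (deriv (deriv f) 0) 0 := by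
    have h : ContDiffAt ℝ 1 (deriv f) 0 :=
      (hf.fderiv_right (m := 1) (by norm_num)).clm_apply contDiffAt_const
    exact (h.differentiableAt (by norm_num)).hasDerivAt
  refine HasDerivAt.lhopital_zero_nhdsNE (f' := deriv f) (g' := fun t => 2 * t) ?_ ?_ ?_ ?_ ?_ ?_
  · exact (hdiff.filter_mono nhdsWithin_le_nhds).mono fun t ht => ht.hasDerivAt
  · exact Eventually.of_forall fun t => by simpa using hasDerivAt_pow 2 t
  · filter_upwards [self_mem_nhdsWithin] with t ht
    exact mul_ne_zero two_ne_zero ht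
  · simpa [h0] using hdiff.self_of_nhds.continuousAt.tendsto.mono_left nhdsWithin_le_nhds
  · have h : Continuous fun t : ℝ => t ^ 2 := by fun_prop
    simpa using (h.tendsto 0).mono_left nhdsWithin_le_nhds
  · have h := (hasDerivAt_iff_tendsto_slope.mp hderiv).div_const 2
    refine h.congr fun t => ?_
    rw [slope_def_field, h1, sub_zero, sub_zero, div_div, mul_comm]

/-- The normalization of a planar vector is invariant under positive scaling. -/
theorem div_sqrt_sq_add_sq_div {c : ℝ} (hc : 0 < c) (x y z : ℝ) :
    z / c / Real.sqrt ((x / c) ^ 2 + (y / c) ^ 2) = z / Real.sqrt (x ^ 2 + y ^ 2) := by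
  rw [div_pow, div_pow, ← add_div, Real.sqrt_div' _ (sq_nonneg c), Real.sqrt_sq hc.le,
    div_div_div_cancel_right₀ hc.ne']

/- STATEMENT 13: At a switching point of order 2 the control is continuous:
if Φ is C² near 0 with Φ(0) = Φ′(0) = (0,0) and Φ″(0) = (α1,α2) ≠ (0,0), then
Φ ≠ 0 near 0 and u = Φ/‖Φ‖ tends to (α1,α2)/√(α1²+α2²) as t → 0, t ≠ 0. -/
theorem order_two_switching
    (ε α1 α2 : ℝ) (hε : 0 < ε) (Φ1 Φ2 : ℝ → ℝ)
    (hC1 : ContDiffOn ℝ 2 Φ1 (Set.Ioo (-ε) ε))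
    (hC2 : ContDiffOn ℝ 2 Φ2 (Set.Ioo (-ε) ε))
    (h0 : Φ1 0 = 0) (h0' : Φ2 0 = 0)
    (h1 : deriv Φ1 0 = 0) (h1' : deriv Φ2 0 = 0)
    (h2 : deriv (deriv Φ1) 0 = α1) (h2' : deriv (deriv Φ2) 0 = α2)
    (hα : (α1, α2) ≠ (0, 0)) :
    (∀ᶠ t in nhdsWithin 0 {(0 : ℝ)}ᶜ, (Φ1 t, Φ2 t) ≠ (0, 0)) ∧
    Tendsto (fun t => (Φ1 t / Real.sqrt ((Φ1 t) ^ 2 + (Φ2 t) ^ 2),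
                       Φ2 t / Real.sqrt ((Φ1 t) ^ 2 + (Φ2 t) ^ 2)))
      (nhdsWithin 0 {(0 : ℝ)}ᶜ)
      (nhds (α1 / Real.sqrt (α1 ^ 2 + α2 ^ 2),
             α2 / Real.sqrt (α1 ^ 2 + α2 ^ 2))) := by
  have hnhds : Set.Ioo (-ε) ε ∈ nhds (0 : ℝ) := Ioo_mem_nhds (neg_lt_zero.mpr hε) hε
  have l1 := tendsto_div_sq_of_contDiffAt_two (hC1.contDiffAt hnhds) h0 h1
  have l2 := tendsto_div_sq_of_contDiffAt_two (hC2.contDiffAt hnhds) h0' h1'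
  rw [h2] at l1
  rw [h2'] at l2
  have hne : (α1 / 2, α2 / 2) ≠ ((0 : ℝ), (0 : ℝ)) := by
    simpa [Prod.ext_iff] using hα
  have hpos : 0 < (α1 / 2) ^ 2 + (α2 / 2) ^ 2 := by
    by_cases h : α1 / 2 = 0
    · have h' : α2 / 2 ≠ 0 := fun h' => hne (by rw [h, h'])
      positivity
    · positivity
  constructor
  · filter_upwards [(l1.prodMk_nhds l2).eventually_ne hne] with t ht h
    obtain ⟨e1, e2⟩ := Prod.mk.inj h
    exact ht (by simp [e1, e2])
  · have hs := ((l1.pow 2).add (l2.pow 2)).sqrt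
    have hs0 := (Real.sqrt_pos.mpr hpos).ne'
    have h := (l1.div hs hs0).prodMk_nhds (l2.div hs hs0)
    rw [div_sqrt_sq_add_sq_div two_pos, div_sqrt_sq_add_sq_div two_pos] at h
    refine h.congr' ?_
    filter_upwards [self_mem_nhdsWithin] with t ht
    have ht2 : 0 < t ^ 2 := sq_pos_of_ne_zero ht
    simp only [Pi.div_apply, div_sqrt_sq_add_sq_div ht2]
end

section
/- The one-sided cubic coefficients at a switching point of order 3 exist and are given explicitly: let b1, b2, c ∈ ℝ with b1² + b2² > c² and (b1, b2) ≠ (0,0), and set d = √(b1² + b2² − c²), β⁺ = (d(b1 d + b2 c)/(b1² + b2²), d(b2 d − b1 c)/(b1² + b2²)) and β⁻ = (d(b1 d − b2 c)/(b1² + b2²), d(b2 d + b1 c)/(b1² + b2²)). Then ‖β⁺‖ = ‖β⁻‖ = d > 0, and β⁺ satisfies β⁺₁ = b1 + c β⁺₂/‖β⁺‖ and β⁺₂ = b2 − c β⁺₁/‖β⁺‖, while β⁻ satisfies β⁻₁ = b1 − c β⁻₂/‖β⁻‖ and β⁻₂ = b2 + c β⁻₁/‖β⁻‖. -/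
/-- For `d > 0` with `d ^ 2 + c ^ 2 = a ^ 2 + b ^ 2`, the explicit vector below has norm `d` and
solves the system `x = a + c * y / ‖(x, y)‖`, `y = b - c * x / ‖(x, y)‖`. -/
lemma cubic_coefficients_of_sq_add_sq {a b c d : ℝ} (hd : 0 < d)
    (h : d ^ 2 + c ^ 2 = a ^ 2 + b ^ 2) {x y : ℝ}
    (hx : x = d * (a * d + b * c) / (a ^ 2 + b ^ 2))
    (hy : y = d * (b * d - a * c) / (a ^ 2 + b ^ 2)) :
    Real.sqrt (x ^ 2 + y ^ 2) = d ∧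
      x = a + c * y / Real.sqrt (x ^ 2 + y ^ 2) ∧
      y = b - c * x / Real.sqrt (x ^ 2 + y ^ 2) := by
  have hN : a ^ 2 + b ^ 2 ≠ 0 := by nlinarith [pow_pos hd 2, sq_nonneg c]
  have hd0 : d ≠ 0 := hd.ne'
  have hnorm : Real.sqrt (x ^ 2 + y ^ 2) = d := by
    rw [Real.sqrt_eq_iff_mul_self_eq (by positivity) hd.le, hx, hy]
    field_simp
    linear_combination (a ^ 2 + b ^ 2) * h
  refine ⟨hnorm, ?_, ?_⟩
  · rw [hnorm, hx, hy]
    field_simp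
    linear_combination a * h
  · rw [hnorm, hx, hy]
    field_simp
    linear_combination b * h

/- STATEMENT 14: the one-sided cubic coefficients at a switching point of order 3
exist and are given explicitly, with ‖β⁺‖ = ‖β⁻‖ = d = √(b1²+b2²−c²) > 0, and they
solve the corresponding fixed-point systems. -/
theorem order_three_cubic_coefficients
    (b1 b2 c : ℝ) (hbc : c ^ 2 < b1 ^ 2 + b2 ^ 2) (hb : (b1, b2) ≠ (0, 0)) :
    let d := Real.sqrt (b1 ^ 2 + b2 ^ 2 - c ^ 2)
    let βp1 := d * (b1 * d + b2 * c) / (b1 ^ 2 + b2 ^ 2)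
    let βp2 := d * (b2 * d - b1 * c) / (b1 ^ 2 + b2 ^ 2)
    let βm1 := d * (b1 * d - b2 * c) / (b1 ^ 2 + b2 ^ 2)
    let βm2 := d * (b2 * d + b1 * c) / (b1 ^ 2 + b2 ^ 2)
    Real.sqrt (βp1 ^ 2 + βp2 ^ 2) = d ∧
    Real.sqrt (βm1 ^ 2 + βm2 ^ 2) = d ∧
    0 < d ∧
    βp1 = b1 + c * βp2 / Real.sqrt (βp1 ^ 2 + βp2 ^ 2) ∧
    βp2 = b2 - c * βp1 / Real.sqrt (βp1 ^ 2 + βp2 ^ 2) ∧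
    βm1 = b1 - c * βm2 / Real.sqrt (βm1 ^ 2 + βm2 ^ 2) ∧
    βm2 = b2 + c * βm1 / Real.sqrt (βm1 ^ 2 + βm2 ^ 2) := by
  intro d βp1 βp2 βm1 βm2
  have hd : 0 < d := Real.sqrt_pos.2 (sub_pos.2 hbc)
  have hsq : d ^ 2 = b1 ^ 2 + b2 ^ 2 - c ^ 2 := Real.sq_sqrt (sub_pos.2 hbc).le
  obtain ⟨hp, hp1, hp2⟩ := cubic_coefficients_of_sq_add_sq (a := b1) (b := b2) (c := c) hd
    (by linarith) (x := βp1) (y := βp2) rfl rfl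
  obtain ⟨hm, hm1, hm2⟩ := cubic_coefficients_of_sq_add_sq (a := b1) (b := b2) (c := -c) hd
    (by linarith [neg_sq c]) (x := βm1) (y := βm2) (by simp only [βm1]; ring)
    (by simp only [βm2]; ring)
  exact ⟨hp, hm, hd, hp1, hp2, hm1.trans (by ring), hm2.trans (by ring)⟩
end
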